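/- There exists a constant C' > 0 such that for every integer N ≥ 2, every bounded measurable probability density ρ on ℝ³, and every X_N = (x₁,…,x_N) ∈ (ℝ³)^N with pairwise distinct components, the modulated potential energy satisfies the lower bound F_N(X_N, ρ) ≥ −C' (1 + ‖ρ‖_{L^∞(ℝ³)}) N^{4/3}. -/

import Mathlib

open MeasureTheory Real
open scoped ENNReal NNReal

noncomputable section

abbrev E3 : Type := EuclideanSpace ℝ (Fin 3)

/-- The repulsive Coulomb potential `V(z) = 1/(4π|z|)` on `ℝ³`. -/
def V (z : E3) : ℝ := (4 * π * ‖z‖)⁻¹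

/-- The empirical measure `μ_{X_N} = (1/N) ∑ δ_{x_j}`. -/
def empMeas {N : ℕ} (X : Fin N → E3) : Measure E3 :=
  (N : ℝ≥0∞)⁻¹ • ∑ j, Measure.dirac (X j)

/-- The measure with density `ρ` with respect to Lebesgue measure. -/
def densMeas (ρ : E3 → ℝ) : Measure E3 :=
  volume.withDensity fun x => ENNReal.ofReal (ρ x)

/-- `∬_{ℝ⁶ ∖ D} w dμ dν`, the integral of `w` over the complement of
the diagonal with respect to the product measure `μ ⊗ ν`. -/
def offDiagInt (w : E3 × E3 → ℝ) (μ ν : Measure E3) : ℝ :=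
  ∫ p in {p : E3 × E3 | p.1 ≠ p.2}, w p ∂(μ.prod ν)

/-- `∬_{ℝ⁶ ∖ D} w d(μ−ν) d(μ−ν)`, expanded bilinearly. -/
def modDouble (w : E3 × E3 → ℝ) (μ ν : Measure E3) : ℝ :=
  offDiagInt w μ μ - offDiagInt w μ ν - offDiagInt w ν μ + offDiagInt w ν ν

/-- The measure on `(ℝ³)^N` with density `ρ_N`. -/
def piDens (N : ℕ) (ρN : (Fin N → E3) → ℝ) : Measure (Fin N → E3) :=
  volume.withDensity fun X => ENNReal.ofReal (ρN X)

/-- Serfaty's modulated potential energy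
`F_N(X_N, ρ) = N² ∬_{ℝ⁶∖D} V(x−y) d(μ_{X_N}−ρ) d(μ_{X_N}−ρ)`. -/
def FN (N : ℕ) (X : Fin N → E3) (ρ : E3 → ℝ) : ℝ :=
  (N : ℝ) ^ 2 * modDouble (fun p => V (p.1 - p.2)) (empMeas X) (densMeas ρ)

lemma comb4 {α : Type*} [MeasurableSpace α] {P : Measure α} {a b c d : α → ℝ}
    (ha : Integrable a P) (hb : Integrable b P) (hc : Integrable c P) (hd : Integrable d P) :
    ∫ x, (a x - b x - c x + d x) ∂P = ∫ x, a x ∂P - ∫ x, b x ∂P - ∫ x, c x ∂P + ∫ x, d x ∂P := by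
  have h1 : Integrable (fun x => a x - b x) P := ha.sub hb
  have h2 : Integrable (fun x => a x - b x - c x) P := h1.sub hc
  rw [integral_add h2 hd, integral_sub h1 hc, integral_sub ha hb]

/-- Gaussian kernel. -/
def GK (t : ℝ) (p : E3 × E3) : ℝ := Real.exp (-(t ^ 2 * ‖p.1 - p.2‖ ^ 2))

/-- Truncated potential. -/
def VT (T : ℝ) (p : E3 × E3) : ℝ := ∫ t in Set.Ioc 0 T, GK t p

lemma GK_cont : Continuous (fun q : (E3 × E3) × ℝ => GK q.2 q.1) := by
  unfold GK; fun_prop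

lemma GK_pos (t : ℝ) (p) : 0 < GK t p := Real.exp_pos _

lemma GK_le_one (t : ℝ) (p) : GK t p ≤ 1 := by
  unfold GK
  apply Real.exp_le_one_iff.2
  have : 0 ≤ t ^ 2 * ‖p.1 - p.2‖ ^ 2 := by positivity
  linarith

lemma GK_int (t : ℝ) (m : Measure (E3 × E3)) [IsFiniteMeasure m] : Integrable (GK t) m := by
  apply Integrable.of_bound (C := 1)
  · exact (GK_cont.comp (by fun_prop : Continuous fun p : E3 × E3 => (p, t))).aestronglyMeasurable
  · exact Filter.Eventually.of_forall fun p => by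
      rw [Real.norm_of_nonneg (GK_pos t p).le]; exact GK_le_one t p

lemma GK_int2 (T : ℝ) (m : Measure (E3 × E3)) [IsFiniteMeasure m] :
    Integrable (Function.uncurry fun p t => GK t p) (m.prod (volume.restrict (Set.Ioc 0 T))) := by
  apply Integrable.of_bound (C := 1)
  · exact GK_cont.aestronglyMeasurable
  · exact Filter.Eventually.of_forall fun p => by
      simp only [Function.uncurry]
      rw [Real.norm_of_nonneg (GK_pos _ _).le]; exact GK_le_one _ _

lemma VT_int (T : ℝ) (m : Measure (E3 × E3)) [IsFiniteMeasure m] : Integrable (VT T) m :=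
  (GK_int2 T m).integral_prod_left

lemma VT_swap (T : ℝ) (m : Measure (E3 × E3)) [IsFiniteMeasure m] :
    ∫ p, VT T p ∂m = ∫ t in Set.Ioc 0 T, ∫ p, GK t p ∂m :=
  integral_integral_swap (GK_int2 T m)

/-- half kernel -/
def HK (t : ℝ) (x z : E3) : ℝ := Real.exp (-(2 * t ^ 2) * ‖z - x‖ ^ 2)

lemma HK_mul (t : ℝ) (x y z : E3) : HK t x z * HK t y z =
    GK t (x, y) * Real.exp (-(4 * t ^ 2) * ‖z - (1/2 : ℝ) • (x + y)‖ ^ 2) := by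
  unfold HK GK
  rw [← Real.exp_add, ← Real.exp_add]
  congr 1
  have h1 := parallelogram_law_with_norm ℝ (z - x) (z - y)
  have h2 : z - x + (z - y) = (2 : ℝ) • (z - (1/2 : ℝ) • (x + y)) := by module
  have h3 : z - x - (z - y) = -(x - y) := by abel
  rw [h2, h3, norm_neg, norm_smul] at h1
  simp only [Real.norm_ofNat] at h1
  simp only
  linear_combination (t ^ 2) * h1

lemma gauss_int {b : ℝ} (hb : 0 < b) : Integrable (fun z : E3 => Real.exp (-b * ‖z‖ ^ 2)) := by
  have := GaussianFourier.integrable_cexp_neg_mul_sq_norm_add (V := E3) (b := (b : ℂ))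
    (by simpa using hb) 0 0
  have h := this.norm
  refine h.congr (Filter.Eventually.of_forall fun z => ?_)
  simp only [Complex.norm_exp]
  congr 1
  simp [← Complex.ofReal_pow]

lemma HK_mul_integral {t : ℝ} (x y : E3) : ∫ z, HK t x z * HK t y z =
    GK t (x, y) * ∫ z : E3, Real.exp (-(4 * t ^ 2) * ‖z‖ ^ 2) := by
  simp_rw [HK_mul]
  rw [integral_const_mul]
  congr 1
  exact integral_sub_right_eq_self (fun z : E3 => Real.exp (-(4 * t ^ 2) * ‖z‖ ^ 2)) _

lemma HK_mul_int {t : ℝ} (ht : 0 < t) (x y : E3) : Integrable fun z => HK t x z * HK t y z := by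
  simp_rw [HK_mul]
  exact ((gauss_int (b := 4 * t ^ 2) (by positivity)).comp_sub_right _).const_mul _

lemma HK_triple {t : ℝ} (ht : 0 < t) (m n : Measure E3) [IsFiniteMeasure m] [IsFiniteMeasure n] :
    Integrable (Function.uncurry fun (p : E3 × E3) z => HK t p.1 z * HK t p.2 z)
      ((m.prod n).prod volume) := by
  have hc : Continuous (Function.uncurry fun (p : E3 × E3) z => HK t p.1 z * HK t p.2 z) := by
    unfold HK Function.uncurry; fun_prop
  rw [integrable_prod_iff hc.aestronglyMeasurable]
  refine ⟨Filter.Eventually.of_forall fun p => HK_mul_int ht p.1 p.2, ?_⟩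
  have : (fun p : E3 × E3 => ∫ z, ‖Function.uncurry (fun (p : E3 × E3) z => HK t p.1 z * HK t p.2 z) (p, z)‖)
      = fun p => GK t p * ∫ z : E3, Real.exp (-(4 * t ^ 2) * ‖z‖ ^ 2) := by
    funext p
    rw [← HK_mul_integral p.1 p.2]
    congr 1
    funext z
    apply Real.norm_of_nonneg
    unfold Function.uncurry HK
    positivity
  rw [this]
  exact (GK_int t _).mul_const _

lemma HK_fub {t : ℝ} (ht : 0 < t) (m n : Measure E3) [IsFiniteMeasure m] [IsFiniteMeasure n] :
    Integrable (fun z => (∫ x, HK t x z ∂m) * (∫ x, HK t x z ∂n)) ∧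
    ∫ z, (∫ x, HK t x z ∂m) * (∫ x, HK t x z ∂n) =
      (∫ p, GK t p ∂(m.prod n)) * ∫ z : E3, Real.exp (-(4 * t ^ 2) * ‖z‖ ^ 2) := by
  have h := HK_triple ht m n
  have e : ∀ z, (∫ p : E3 × E3, HK t p.1 z * HK t p.2 z ∂(m.prod n)) =
     (∫ x, HK t x z ∂m) * (∫ x, HK t x z ∂n) := fun z =>
    integral_prod_mul (fun x => HK t x z) (fun y => HK t y z)
  constructor
  · have := h.integral_prod_right
    simp only [Function.uncurry, e] at this
    exact this
  · have := integral_integral_swap h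
    simp only [e, HK_mul_integral] at this
    rw [← this, integral_mul_const]

lemma gauss_val {b : ℝ} (hb : 0 < b) :
    ∫ z : E3, Real.exp (-b * ‖z‖ ^ 2) = (π / b) ^ ((3 : ℝ) / 2) := by
  have := GaussianFourier.integral_rexp_neg_mul_sq_norm (V := E3) hb
  simpa using this

lemma GK_psd {t : ℝ} (ht : 0 < t) (m n : Measure E3) [IsFiniteMeasure m] [IsFiniteMeasure n] :
    0 ≤ ∫ p, GK t p ∂(m.prod m) - ∫ p, GK t p ∂(m.prod n) - ∫ p, GK t p ∂(n.prod m)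
      + ∫ p, GK t p ∂(n.prod n) := by
  obtain ⟨i1, e1⟩ := HK_fub ht m m
  obtain ⟨i2, e2⟩ := HK_fub ht m n
  obtain ⟨i3, e3⟩ := HK_fub ht n m
  obtain ⟨i4, e4⟩ := HK_fub ht n n
  have hc : 0 < ∫ z : E3, Real.exp (-(4 * t ^ 2) * ‖z‖ ^ 2) := by
    rw [gauss_val (by positivity)]; positivity
  have h0 : 0 ≤ ∫ z, ((∫ x, HK t x z ∂m) - (∫ x, HK t x z ∂n)) ^ 2 :=
    integral_nonneg fun z => sq_nonneg _
  have h1 : ∫ z, ((∫ x, HK t x z ∂m) - (∫ x, HK t x z ∂n)) ^ 2 =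
     ∫ z, ((∫ x, HK t x z ∂m) * (∫ x, HK t x z ∂m) - (∫ x, HK t x z ∂m) * (∫ x, HK t x z ∂n)
      - (∫ x, HK t x z ∂n) * (∫ x, HK t x z ∂m) + (∫ x, HK t x z ∂n) * (∫ x, HK t x z ∂n)) := by
    congr 1; funext z; ring
  rw [h1, comb4 i1 i2 i3 i4,
    e1, e2, e3, e4, ← sub_mul, ← sub_mul, ← add_mul] at h0
  exact nonneg_of_mul_nonneg_left h0 hc

lemma VT_psd (T : ℝ) (m n : Measure E3) [IsFiniteMeasure m] [IsFiniteMeasure n] :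
    0 ≤ ∫ p, VT T p ∂(m.prod m) - ∫ p, VT T p ∂(m.prod n) - ∫ p, VT T p ∂(n.prod m)
      + ∫ p, VT T p ∂(n.prod n) := by
  simp only [VT_swap]
  have i1 := (GK_int2 T (m.prod m)).integral_prod_right
  have i2 := (GK_int2 T (m.prod n)).integral_prod_right
  have i3 := (GK_int2 T (n.prod m)).integral_prod_right
  have i4 := (GK_int2 T (n.prod n)).integral_prod_right
  simp only [Function.uncurry] at i1 i2 i3 i4
  rw [← comb4 i1 i2 i3 i4]
  apply setIntegral_nonneg measurableSet_Ioc
  intro t ht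
  exact GK_psd ht.1 m n

lemma VT_nonneg (T : ℝ) (p) : 0 ≤ VT T p := integral_nonneg fun t => (GK_pos t p).le

lemma VT_le {T : ℝ} (hT : 0 ≤ T) (p) : VT T p ≤ T := by
  have h := norm_setIntegral_le_of_norm_le_const (μ := volume) (s := Set.Ioc 0 T) (C := 1)
    (f := fun t => GK t p) (by simp) (fun t _ => by
      rw [Real.norm_of_nonneg (GK_pos _ _).le]; exact GK_le_one _ _)
  have h2 : VT T p ≤ ‖∫ t in Set.Ioc 0 T, GK t p‖ := Real.le_norm_self _
  simp [hT] at h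
  exact h2.trans (by simpa using h)

/-- constant -/
def kk : ℝ := (2 * π * √π)⁻¹

lemma kk_pos : 0 < kk := by unfold kk; positivity

lemma V_eq (p : E3 × E3) : V (p.1 - p.2) = kk * ∫ t in Set.Ioi 0, GK t p := by
  have h : ∀ t, GK t p = Real.exp (-(‖p.1 - p.2‖ ^ 2) * t ^ 2) := fun t => by
    unfold GK; congr 1; ring
  simp only [h]
  rw [integral_gaussian_Ioi, Real.sqrt_div pi_pos.le, Real.sqrt_sq (norm_nonneg _)]
  unfold V kk
  by_cases hz : ‖p.1 - p.2‖ = 0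
  · simp [hz]
  have := Real.sqrt_pos.2 pi_pos
  field_simp
  norm_num

lemma GK_intOn {p : E3 × E3} (hp : p.1 ≠ p.2) : IntegrableOn (fun t => GK t p) (Set.Ioi 0) := by
  have h : ∀ t, GK t p = Real.exp (-(‖p.1 - p.2‖ ^ 2) * t ^ 2) := fun t => by
    unfold GK; congr 1; ring
  simp only [h]
  have : 0 < ‖p.1 - p.2‖ := norm_pos_iff.2 (sub_ne_zero.2 hp)
  exact (integrable_exp_neg_mul_sq (by positivity)).integrableOn

lemma V_sub {T : ℝ} (hT : 0 ≤ T) {p : E3 × E3} (hp : p.1 ≠ p.2) :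
    V (p.1 - p.2) - kk * VT T p = kk * ∫ t in Set.Ioi T, GK t p := by
  rw [V_eq, VT, ← mul_sub, ← Set.Ioc_union_Ioi_eq_Ioi hT, setIntegral_union]
  · ring
  · exact Set.Ioc_disjoint_Ioi le_rfl
  · exact measurableSet_Ioi
  · exact (GK_intOn hp).mono_set Set.Ioc_subset_Ioi_self
  · exact (GK_intOn hp).mono_set (Set.Ioi_subset_Ioi hT)

lemma VT_le_V {T : ℝ} (hT : 0 ≤ T) {p : E3 × E3} (hp : p.1 ≠ p.2) :
    kk * VT T p ≤ V (p.1 - p.2) := by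
  have := V_sub hT hp
  have h2 : 0 ≤ ∫ t in Set.Ioi T, GK t p := integral_nonneg fun t => (GK_pos t p).le
  have := mul_nonneg kk_pos.le h2
  linarith

/-- remainder -/
def BB (T : ℝ) (p : E3 × E3) : ℝ≥0∞ :=
  ENNReal.ofReal kk * ∫⁻ t in Set.Ioi T, ENNReal.ofReal (GK t p)

lemma V_sub_le {T : ℝ} (hT : 0 ≤ T) (p : E3 × E3) :
    ENNReal.ofReal (V (p.1 - p.2) - kk * VT T p) ≤ BB T p := by
  by_cases hp : p.1 = p.2
  · rw [ENNReal.ofReal_of_nonpos]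
    · exact zero_le
    · have := mul_nonneg kk_pos.le (VT_nonneg T p)
      simp [V, hp]; exact this
  · rw [V_sub hT hp, ENNReal.ofReal_mul kk_pos.le, BB,
      ofReal_integral_eq_lintegral_ofReal ((GK_intOn hp).mono_set (Set.Ioi_subset_Ioi hT))]
    exact Filter.Eventually.of_forall fun t => (GK_pos t p).le

lemma BB_meas (T : ℝ) : Measurable (BB T) := by
  unfold BB
  apply Measurable.const_mul
  apply Measurable.lintegral_prod_right (f := fun (p : E3 × E3) (t : ℝ) => ENNReal.ofReal (GK t p))
  exact GK_cont.measurable.ennreal_ofReal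

lemma BB_int {T : ℝ} (hT : 0 < T) (x : E3) :
    ∫⁻ y, BB T (x, y) = ENNReal.ofReal (1 / (4 * T ^ 2)) := by
  unfold BB
  rw [lintegral_const_mul']
  swap
  · simp
  rw [lintegral_lintegral_swap]
  swap
  · apply Measurable.aemeasurable
    apply Measurable.ennreal_ofReal
    unfold GK
    fun_prop
  have h : ∀ t ∈ Set.Ioi T, ∫⁻ y, ENNReal.ofReal (GK t (x, y)) =
      ENNReal.ofReal (π ^ ((3 : ℝ)/2) * t ^ (-3 : ℝ)) := by
    intro t ht
    have ht0 : 0 < t := hT.trans ht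
    have e : ∀ y, GK t (x, y) = (fun z : E3 => Real.exp (-(t ^ 2) * ‖z‖ ^ 2)) (y - x) := fun y => by
      unfold GK; simp only; rw [norm_sub_rev]; congr 1; ring
    have hi := gauss_int (b := t ^ 2) (by positivity)
    simp only [e]
    rw [← ofReal_integral_eq_lintegral_ofReal (hi.comp_sub_right x)
      (Filter.Eventually.of_forall fun z => (Real.exp_pos _).le),
      integral_sub_right_eq_self (fun z : E3 => Real.exp (-(t ^ 2) * ‖z‖ ^ 2)),
      gauss_val (by positivity)]
    congr 1
    rw [Real.div_rpow pi_pos.le (by positivity), div_eq_mul_inv, ← Real.rpow_natCast, ← Real.rpow_mul ht0.le,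
      Real.rpow_neg ht0.le]
    norm_num
  rw [setLIntegral_congr_fun measurableSet_Ioi h, ← ofReal_integral_eq_lintegral_ofReal,
    integral_const_mul, integral_Ioi_rpow_of_lt (by norm_num) hT, ← ENNReal.ofReal_mul kk_pos.le]
  · congr 1
    unfold kk
    have e1 : π ^ ((3 : ℝ)/2) = π * √π := by
      rw [show (3 : ℝ)/2 = 1 + 1/2 by norm_num, Real.rpow_add pi_pos, Real.rpow_one, Real.sqrt_eq_rpow]
    have e2 : T ^ ((-3 : ℝ) + 1) = (T ^ 2)⁻¹ := by
      rw [show (-3 : ℝ) + 1 = -(2 : ℕ) by norm_num, Real.rpow_neg hT.le, Real.rpow_natCast]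
    have := Real.sqrt_pos.2 pi_pos
    rw [e1, e2]
    field_simp
    norm_num
  · exact ((integrableOn_Ioi_rpow_of_lt (by norm_num) hT).const_mul _)
  · refine (ae_restrict_iff' measurableSet_Ioi).2 (Filter.Eventually.of_forall fun t ht => ?_)
    have : 0 < t := hT.trans ht
    simp only [Pi.zero_apply]
    positivity

lemma BB_dens {T : ℝ} (hT : 0 < T) {ρ : E3 → ℝ} (hρ : Measurable ρ) {M : ℝ}
    (hM : ∀ x, ρ x ≤ M) (m : Measure E3) [IsProbabilityMeasure m] [SFinite (densMeas ρ)] :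
    ∫⁻ p, BB T p ∂(m.prod (densMeas ρ)) ≤ ENNReal.ofReal M * ENNReal.ofReal (1 / (4 * T ^ 2)) := by
  rw [lintegral_prod _ (BB_meas T).aemeasurable]
  have h : ∀ x, ∫⁻ y, BB T (x, y) ∂(densMeas ρ) ≤
      ENNReal.ofReal M * ENNReal.ofReal (1 / (4 * T ^ 2)) := by
    intro x
    unfold densMeas
    have hb : Measurable fun y => BB T (x, y) := (BB_meas T).comp measurable_prodMk_left
    rw [lintegral_withDensity_eq_lintegral_mul _ hρ.ennreal_ofReal hb, ← BB_int hT x, ← lintegral_const_mul' _ _ (by simp)]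
    apply lintegral_mono
    intro y
    exact mul_le_mul_left (ENNReal.ofReal_le_ofReal (hM y)) _
  calc _ ≤ ∫⁻ x, ENNReal.ofReal M * ENNReal.ofReal (1 / (4 * T ^ 2)) ∂m := lintegral_mono h
    _ = _ := by simp

lemma V_meas : Measurable fun p : E3 × E3 => V (p.1 - p.2) := by
  unfold V; fun_prop

lemma V_nonneg (z) : 0 ≤ V z := by unfold V; positivity

lemma V_int_dens {ρ : E3 → ℝ} (hρ : Measurable ρ) {M : ℝ}
    (hM : ∀ x, ρ x ≤ M) (m : Measure E3) [IsProbabilityMeasure m] [IsFiniteMeasure (densMeas ρ)] :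
    Integrable (fun p : E3 × E3 => V (p.1 - p.2)) (m.prod (densMeas ρ)) := by
  refine ⟨V_meas.aestronglyMeasurable, ?_⟩
  rw [hasFiniteIntegral_iff_ofReal (Filter.Eventually.of_forall fun p => V_nonneg _)]
  calc _ ≤ ∫⁻ p, (ENNReal.ofReal kk + BB 1 p) ∂(m.prod (densMeas ρ)) := by
        apply lintegral_mono
        intro p
        have h1 := V_sub_le zero_le_one p
        have h2 : V (p.1 - p.2) = kk * VT 1 p + (V (p.1 - p.2) - kk * VT 1 p) := by ring
        simp only
        rw [h2]
        refine ENNReal.ofReal_add_le.trans (add_le_add (ENNReal.ofReal_le_ofReal ?_) h1)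
        have := mul_le_mul_of_nonneg_left (VT_le zero_le_one p) kk_pos.le
        linarith
    _ < ⊤ := by
        rw [lintegral_add_left measurable_const]
        apply ENNReal.add_lt_top.2 ⟨?_, ?_⟩
        · simp only [lintegral_const]
          exact ENNReal.mul_lt_top ENNReal.ofReal_lt_top (measure_lt_top _ _)
        · refine (BB_dens one_pos hρ hM m).trans_lt ?_
          exact ENNReal.mul_lt_top ENNReal.ofReal_lt_top ENNReal.ofReal_lt_top

lemma offDiag_eq (m n : Measure E3) : offDiagInt (fun p => V (p.1 - p.2)) m n =
    ∫ p, V (p.1 - p.2) ∂(m.prod n) := by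
  apply setIntegral_eq_integral_of_forall_compl_eq_zero
  intro p hp
  have : p.1 = p.2 := by simpa using hp
  simp [V, this]

lemma upper {T : ℝ} (hT : 0 < T) {ρ : E3 → ℝ} (hρ : Measurable ρ) {M : ℝ} (hM0 : 0 ≤ M)
    (hM : ∀ x, ρ x ≤ M) (m : Measure E3) [IsProbabilityMeasure m] [IsFiniteMeasure (densMeas ρ)] :
    ∫ p, V (p.1 - p.2) ∂(m.prod (densMeas ρ)) ≤
      kk * ∫ p, VT T p ∂(m.prod (densMeas ρ)) + M * (1 / (4 * T ^ 2)) := by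
  have i1 := V_int_dens hρ hM m
  have i2 := (VT_int T (m.prod (densMeas ρ))).const_mul kk
  have h : ∫ p, (V (p.1 - p.2) - kk * VT T p) ∂(m.prod (densMeas ρ)) ≤ M * (1 / (4 * T ^ 2)) := by
    have i3 : Integrable (fun p : E3 × E3 => V (p.1 - p.2) - kk * VT T p) (m.prod (densMeas ρ)) :=
      i1.sub i2
    rw [integral_eq_lintegral_pos_part_sub_lintegral_neg_part i3]
    have a : (∫⁻ p, ENNReal.ofReal (V (p.1 - p.2) - kk * VT T p) ∂(m.prod (densMeas ρ))) ≤
      ENNReal.ofReal (M * (1 / (4 * T ^ 2))) := by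
      rw [ENNReal.ofReal_mul hM0]
      exact (lintegral_mono (V_sub_le hT.le)).trans (BB_dens hT hρ hM m)
    have b := ENNReal.toReal_mono ENNReal.ofReal_ne_top a
    rw [ENNReal.toReal_ofReal (by positivity)] at b
    refine (sub_le_self _ ENNReal.toReal_nonneg).trans b
  rw [integral_sub i1 i2, integral_const_mul] at h
  linarith

lemma diag_meas : MeasurableSet {p : E3 × E3 | p.1 = p.2} :=
  measurableSet_eq_fun measurable_fst measurable_snd

lemma lower {T : ℝ} (hT : 0 < T) (P : Measure (E3 × E3)) [IsFiniteMeasure P]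
    (hi : Integrable (fun p : E3 × E3 => V (p.1 - p.2)) P) :
    kk * ∫ p, VT T p ∂P - P.real {p : E3 × E3 | p.1 = p.2} * (kk * T) ≤
      ∫ p, V (p.1 - p.2) ∂P := by
  have i2 := (VT_int T P).const_mul kk
  have i3 : Integrable (Set.indicator {p : E3 × E3 | p.1 = p.2} fun _ => kk * T) P :=
    (integrable_const _).indicator diag_meas
  have e3 := integral_indicator_const (μ := P) (kk * T) diag_meas
  rw [smul_eq_mul] at e3
  rw [← e3, ← integral_const_mul, ← integral_sub i2 i3]
  apply integral_mono (i2.sub i3) hi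
  intro p
  simp only [Pi.sub_apply]
  by_cases hp : p.1 = p.2
  · rw [Set.indicator_of_mem (by exact hp)]
    have := mul_le_mul_of_nonneg_left (VT_le hT.le p) kk_pos.le
    have := V_nonneg (p.1 - p.2)
    linarith
  · rw [Set.indicator_of_notMem (by exact hp)]
    have := VT_le_V hT.le hp
    linarith

lemma emp_prob {N : ℕ} (hN : 2 ≤ N) (X : Fin N → E3) : IsProbabilityMeasure (empMeas X) := by
  constructor
  simp only [empMeas, Measure.smul_apply, Measure.finsetSum_apply, measure_univ, smul_eq_mul]
  simp
  exact ENNReal.inv_mul_cancel (by simp; omega) (by simp)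

lemma emp_ae {N : ℕ} (X : Fin N → E3) : ∀ᵐ x ∂(empMeas X), x ∈ Set.range X := by
  have hm : MeasurableSet (Set.range X)ᶜ := (Set.finite_range X).measurableSet.compl
  rw [ae_iff]
  change empMeas X (Set.range X)ᶜ = 0
  simp only [empMeas, Measure.smul_apply, Measure.finsetSum_apply, smul_eq_mul,
    Measure.dirac_apply' _ hm]
  simp

lemma emp_int {N : ℕ} (hN : 2 ≤ N) (X : Fin N → E3) :
    Integrable (fun p : E3 × E3 => V (p.1 - p.2)) ((empMeas X).prod (empMeas X)) := by
  have := emp_prob hN X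
  apply Integrable.of_bound (C := ∑ i, ∑ j, V (X i - X j)) V_meas.aestronglyMeasurable
  have h1 := (Measure.quasiMeasurePreserving_fst (μ := empMeas X) (ν := empMeas X)).ae (emp_ae X)
  have h2 := (Measure.quasiMeasurePreserving_snd (μ := empMeas X) (ν := empMeas X)).ae (emp_ae X)
  filter_upwards [h1, h2] with p hp1 hp2
  obtain ⟨i, hi⟩ := hp1
  obtain ⟨j, hj⟩ := hp2
  rw [← hi, ← hj, Real.norm_of_nonneg (V_nonneg _)]
  refine le_trans ?_ (Finset.single_le_sum (f := fun i => ∑ j, V (X i - X j))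
    (fun i _ => Finset.sum_nonneg fun j _ => V_nonneg _) (Finset.mem_univ i))
  exact Finset.single_le_sum (f := fun j => V (X i - X j)) (fun j _ => V_nonneg _)
    (Finset.mem_univ j)

lemma emp_single {N : ℕ} (X : Fin N → E3) (hX : Function.Injective X) (x : E3) :
    empMeas X {x} ≤ (N : ℝ≥0∞)⁻¹ := by
  simp only [empMeas, Measure.smul_apply, Measure.finsetSum_apply, smul_eq_mul,
    Measure.dirac_apply' _ (measurableSet_singleton x)]
  refine mul_le_of_le_one_right' ?_
  by_cases h : ∃ i, X i = x
  · obtain ⟨i, rfl⟩ := h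
    rw [Finset.sum_eq_single i]
    · simp
    · intro j _ hj
      simp [hX.ne hj]
    · simp
  · push Not at h
    simp [h]

lemma emp_diag {N : ℕ} (hN : 2 ≤ N) (X : Fin N → E3) (hX : Function.Injective X) :
    ((empMeas X).prod (empMeas X)).real {p : E3 × E3 | p.1 = p.2} ≤ (N : ℝ)⁻¹ := by
  have := emp_prob hN X
  have h : ((empMeas X).prod (empMeas X)) {p : E3 × E3 | p.1 = p.2} ≤ (N : ℝ≥0∞)⁻¹ := by
    rw [Measure.prod_apply diag_meas]
    calc _ ≤ ∫⁻ x, (N : ℝ≥0∞)⁻¹ ∂(empMeas X) := by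
          apply lintegral_mono
          intro x
          refine le_trans (measure_mono ?_) (emp_single X hX x)
          intro y hy
          exact (Eq.symm hy : y = x)
      _ = _ := by simp
  have h2 := ENNReal.toReal_mono (by simp; omega) h
  simpa [Measure.real] using h2

lemma dens_diag (ρ : E3 → ℝ) [IsFiniteMeasure (densMeas ρ)] :
    ((densMeas ρ).prod (densMeas ρ)).real {p : E3 × E3 | p.1 = p.2} = 0 := by
  have h : ((densMeas ρ).prod (densMeas ρ)) {p : E3 × E3 | p.1 = p.2} = 0 := by
    rw [Measure.measure_prod_null diag_meas]
    refine Filter.Eventually.of_forall fun x => ?_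
    have : Prod.mk x ⁻¹' {p : E3 × E3 | p.1 = p.2} = {x} := by
      ext y; simp [eq_comm]
    simp only [this]
    exact withDensity_absolutelyContinuous _ _ (measure_singleton x)
  simp [Measure.real, h]

lemma dens_prob {ρ : E3 → ℝ} (h0 : ∀ x, 0 ≤ ρ x) (h1 : (∫ x, ρ x) = 1) :
    IsProbabilityMeasure (densMeas ρ) := by
  have hi : Integrable ρ := by
    by_contra h
    rw [integral_undef h] at h1
    norm_num at h1
  constructor
  rw [densMeas, withDensity_apply _ MeasurableSet.univ, Measure.restrict_univ,
    ← ofReal_integral_eq_lintegral_ofReal hi (Filter.Eventually.of_forall h0), h1]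
  simp

lemma V_symm (m n : Measure E3) [IsFiniteMeasure m] [IsFiniteMeasure n] :
    ∫ p, V (p.1 - p.2) ∂(m.prod n) = ∫ p, V (p.1 - p.2) ∂(n.prod m) := by
  rw [← integral_prod_swap]
  congr 1
  funext p
  simp [V, norm_sub_rev]

lemma VT_symm (T : ℝ) (m n : Measure E3) [IsFiniteMeasure m] [IsFiniteMeasure n] :
    ∫ p, VT T p ∂(m.prod n) = ∫ p, VT T p ∂(n.prod m) := by
  rw [← integral_prod_swap]
  congr 1
  funext p
  simp [VT, GK, norm_sub_rev]

theorem statement18 :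
    ∃ C' : ℝ, 0 < C' ∧
      ∀ (N : ℕ), 2 ≤ N →
      ∀ ρ : E3 → ℝ, Measurable ρ → (∀ x, 0 ≤ ρ x) → (∫ x, ρ x) = 1 →
      ∀ M : ℝ, (∀ x, ρ x ≤ M) →
      ∀ X : Fin N → E3, Function.Injective X →
        -(C' * (1 + M) * (N : ℝ) ^ ((4 : ℝ) / 3)) ≤ FN N X ρ := by
  refine ⟨kk + 1, by have := kk_pos; linarith, ?_⟩
  intro N hN ρ hρ h0 h1 M hM X hX
  have hM0 : 0 ≤ M := (h0 0).trans (hM 0)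
  have := emp_prob hN X
  have := dens_prob h0 h1
  have hNpos : (0 : ℝ) < N := by exact_mod_cast (by omega : 0 < N)
  obtain ⟨T, hTdef⟩ : ∃ T : ℝ, T = (N : ℝ) ^ ((1 : ℝ) / 3) := ⟨_, rfl⟩
  have hT : 0 < T := by rw [hTdef]; positivity
  have hT3 : T ^ 3 = N := by
    rw [hTdef, ← Real.rpow_natCast, ← Real.rpow_mul hNpos.le]; norm_num
  have hT4 : (N : ℝ) ^ ((4 : ℝ) / 3) = T ^ 4 := by
    rw [hTdef, ← Real.rpow_natCast, ← Real.rpow_mul hNpos.le]; norm_num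
  have psd := mul_nonneg kk_pos.le (VT_psd T (empMeas X) (densMeas ρ))
  have up := upper hT hρ hM0 hM (empMeas X)
  have lo1 := lower hT _ (emp_int hN X)
  have lo2 := lower hT _ (V_int_dens hρ hM (densMeas ρ))
  rw [dens_diag, zero_mul, sub_zero] at lo2
  have dg := mul_le_mul_of_nonneg_right (emp_diag hN X hX) (mul_pos kk_pos hT).le
  rw [VT_symm T (densMeas ρ) (empMeas X)] at psd
  unfold FN modDouble
  simp only [offDiag_eq]
  rw [V_symm (densMeas ρ) (empMeas X), hT4]
  have key : -((N : ℝ)⁻¹ * (kk * T)) - 2 * (M * (1 / (4 * T ^ 2))) ≤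
      ∫ p, V (p.1 - p.2) ∂((empMeas X).prod (empMeas X))
      - ∫ p, V (p.1 - p.2) ∂((empMeas X).prod (densMeas ρ))
      - ∫ p, V (p.1 - p.2) ∂((empMeas X).prod (densMeas ρ))
      + ∫ p, V (p.1 - p.2) ∂((densMeas ρ).prod (densMeas ρ)) := by
    linarith
  have key2 := mul_le_mul_of_nonneg_left key (sq_nonneg (N : ℝ))
  refine le_trans ?_ key2
  rw [← hT3]
  have e : (T ^ 3) ^ 2 * (-((T ^ 3)⁻¹ * (kk * T)) - 2 * (M * (1 / (4 * T ^ 2)))) =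
      -(kk * T ^ 4) - M / 2 * T ^ 4 := by
    field_simp
    ring
  rw [e]
  have hk := kk_pos
  have hT4' : 0 < T ^ 4 := by positivity
  have : kk + M / 2 ≤ (kk + 1) * (1 + M) := by nlinarith [mul_nonneg hk.le hM0]
  have := mul_le_mul_of_nonneg_right this hT4'.le
  linarith
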